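/- For all integers m, n ≥ 2, the one-relation monoid R_{m,n} = Mon⟨a, b | (b a^n)^m (a^n b)^m a = a⟩ contains a fixed rational subset in which membership is undecidable: there exists a regular language L over the alphabet {a, b} such that the predicate on words w ∈ {a, b}* given by 'the element of R_{m,n} represented by w lies in the set of elements represented by words of L' is not computable. -/

import Mathlib

/-- The `i`-fold concatenation of a word with itself. -/
def listPow {σ : Type*} (w : List σ) (i : ℕ) : List σ :=
  (List.replicate i w).flatten

/-- The one-relation monoid `Mon⟨A | u = v⟩` over the alphabet `Fin k`. -/
abbrev OneRelMonoid {k : ℕ} (u v : List (Fin k)) :=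
  PresentedMonoid (fun x y : FreeMonoid (Fin k) =>
    x = FreeMonoid.ofList u ∧ y = FreeMonoid.ofList v)

/-- Evaluation of a word in the one-relation monoid. -/
def OneRelMonoid.eval {k : ℕ} (u v : List (Fin k)) (w : List (Fin k)) :
    OneRelMonoid u v :=
  PresentedMonoid.mk _ (FreeMonoid.ofList w)

/-- The letter `a`. -/
def aw : List (Fin 2) := [0]

/-- The letter `b`. -/
def bw : List (Fin 2) := [1]

/-- The word `(b a^n)^m (a^n b)^m a`, the left-hand side of the defining relation of
`R_{m,n} = Mon⟨a, b | (b a^n)^m (a^n b)^m a = a⟩`. -/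
def rmnLhs (m n : ℕ) : List (Fin 2) :=
  listPow (bw ++ listPow aw n) m ++ listPow (listPow aw n ++ bw) m ++ aw

/-- The one-relation monoid `R_{m,n} = Mon⟨a, b | (b a^n)^m (a^n b)^m a = a⟩`. -/
abbrev Rmn (m n : ℕ) := OneRelMonoid (rmnLhs m n) aw

namespace Language

open scoped Computability

variable {α : Type*}

/-- The union of a set of languages. -/
def unionOf (S : Set (Language α)) : Language α := {y | ∃ Q ∈ S, y ∈ Q}

theorem IsRegular.singleton (w : List α) : IsRegular ({w} : Set (List α)) := by
  refine IsRegular.of_finite_range_leftQuotient ?_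
  have hfin : ({y : List α | y <:+ w}).Finite := by
    refine (List.finite_toSet w.tails).subset fun y hy => ?_
    simpa using hy
  refine hfin.finite_subsets.subset ?_
  rintro _ ⟨x, rfl⟩ y hy
  exact ⟨x, hy⟩

theorem IsRegular.mul {L₁ L₂ : Language α} (h₁ : L₁.IsRegular) (h₂ : L₂.IsRegular) :
    (L₁ * L₂).IsRegular := by
  refine IsRegular.of_finite_range_leftQuotient ?_
  let F : Language α × Set (Language α) → Language α := fun p =>
    p.1 * L₂ + unionOf p.2
  refine ((h₁.finite_range_leftQuotient.prod
    h₂.finite_range_leftQuotient.finite_subsets).image F).subset ?_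
  rintro _ ⟨x, rfl⟩
  refine ⟨(L₁.leftQuotient x, {Q | ∃ u v, u ++ v = x ∧ u ∈ L₁ ∧ Q = L₂.leftQuotient v}),
    ⟨⟨x, rfl⟩, ?_⟩, ?_⟩
  · rintro _ ⟨u, v, -, -, rfl⟩
    exact ⟨v, rfl⟩
  · ext y
    change y ∈ _ * _ + unionOf _ ↔ _
    rw [mem_leftQuotient, mem_add, mem_mul, mem_mul]
    constructor
    · rintro (⟨s, hs, t, ht, rfl⟩ | ⟨_, ⟨u, v, rfl, hu, rfl⟩, hy⟩)
      · exact ⟨x ++ s, hs, t, ht, by simp⟩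
      · exact ⟨u, hu, v ++ y, hy, by simp⟩
    · rintro ⟨s, hs, t, ht, h⟩
      rcases List.append_eq_append_iff.1 h with ⟨c, rfl, rfl⟩ | ⟨c, rfl, rfl⟩
      · exact .inr ⟨_, ⟨s, c, rfl, hs, rfl⟩, ht⟩
      · exact .inl ⟨c, hs, t, ht, rfl⟩

theorem append_mem_kstar {L : Language α} {u v : List α} (hu : u ∈ L∗) (hv : v ∈ L∗) :
    u ++ v ∈ L∗ := by
  obtain ⟨S, rfl, hS⟩ := mem_kstar.1 hu
  obtain ⟨T, rfl, hT⟩ := mem_kstar.1 hv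
  refine mem_kstar.2 ⟨S ++ T, by simp, fun y hy => ?_⟩
  rcases List.mem_append.1 hy with h | h
  exacts [hS y h, hT y h]

theorem mem_kstar_of_mem {L : Language α} {u : List α} (hu : u ∈ L) : u ∈ L∗ :=
  mem_kstar.2 ⟨[u], by simp, by simpa using hu⟩

theorem exists_split_of_append_mem_kstar {L : Language α} {x y : List α} (hx : x ≠ [])
    (h : x ++ y ∈ L∗) :
    ∃ u v s t, u ++ v = x ∧ s ++ t = y ∧ u ∈ L∗ ∧ v ++ s ∈ L ∧ t ∈ L∗ := by
  obtain ⟨S, hS, hL⟩ := mem_kstar.1 h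
  clear h
  induction S generalizing x with
  | nil => simp_all
  | cons l S ih =>
    have hl : l ∈ L := hL l (by simp)
    have hS' : ∀ z ∈ S, z ∈ L := fun z hz => hL z (by simp [hz])
    rw [List.flatten_cons] at hS
    rcases List.append_eq_append_iff.1 hS with ⟨c, rfl, rfl⟩ | ⟨c, rfl, hc⟩
    · exact ⟨[], x, c, S.flatten, rfl, rfl, nil_mem_kstar _, hl, join_mem_kstar hS'⟩
    · rcases eq_or_ne c [] with rfl | hc0
      · refine ⟨[], l, [], y, by simp, rfl, nil_mem_kstar _, by simpa using hl, ?_⟩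
        simp only [List.nil_append] at hc
        exact hc ▸ join_mem_kstar hS'
      · obtain ⟨u, v, s, t, rfl, rfl, hu, hv, ht⟩ := ih hc0 hc.symm hS'
        exact ⟨l ++ u, v, s, t, by simp, rfl,
          append_mem_kstar (mem_kstar_of_mem hl) hu, hv, ht⟩

theorem IsRegular.kstar {L : Language α} (h : L.IsRegular) : L∗.IsRegular := by
  refine IsRegular.of_finite_range_leftQuotient ?_
  let F : Set (Language α) → Language α := fun p => unionOf p * L∗
  refine ((h.finite_range_leftQuotient.finite_subsets.image F).insert L∗).subset ?_
  rintro _ ⟨x, rfl⟩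
  rcases eq_or_ne x [] with rfl | hx
  · exact .inl rfl
  refine .inr ⟨{Q | ∃ u v, u ++ v = x ∧ u ∈ L∗ ∧ Q = L.leftQuotient v}, ?_, ?_⟩
  · rintro _ ⟨u, v, -, -, rfl⟩
    exact ⟨v, rfl⟩
  · ext y
    change y ∈ unionOf _ * _ ↔ _
    rw [mem_leftQuotient, mem_mul]
    constructor
    · rintro ⟨s, ⟨_, ⟨u, v, rfl, hu, rfl⟩, hs⟩, t, ht, rfl⟩
      have : u ++ ((v ++ s) ++ t) ∈ L∗ :=
        append_mem_kstar hu (append_mem_kstar (mem_kstar_of_mem hs) ht)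
      simpa using this
    · intro hy
      obtain ⟨u, v, s, t, huv, hst, hu, hv, ht⟩ := exists_split_of_append_mem_kstar hx hy
      exact ⟨s, ⟨_, ⟨u, v, huv, hu, rfl⟩, hv⟩, t, ht, hst⟩

end Language

/-- Consequences of the relation `x ^ m * y ^ m * a = a`, where `x = b * t`, `y = t * b` and `t` is
a power of `a`. Here `X = x ^ m`, `Y = y ^ m` and `x' = x ^ (m - 1)`. -/
structure RelatorIdentities {M : Type*} [Monoid M] (a b t t' x' X Y : M) : Prop where
  rel : X * Y * a = a
  t_eq : t = a * t'
  t_eq' : t = t' * a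
  Y_mul_t : Y * t = t * X
  X_eq : X = x' * b * t
  X_eq' : X = b * t * x'
  exists_Y_eq : ∃ w, Y = a * w

namespace RelatorIdentities

variable {M : Type*} [Monoid M] {a b t t' x' X Y : M}

theorem t_comm (H : RelatorIdentities a b t t' x' X Y) : t * a = a * t := by
  conv_lhs => rw [H.t_eq, mul_assoc, ← H.t_eq']

theorem X_t_X (H : RelatorIdentities a b t t' x' X Y) : X * t * X = t := calc
  X * t * X = X * (Y * t) := by rw [H.Y_mul_t, mul_assoc]
  _ = X * Y * a * t' := by rw [H.t_eq]; simp only [mul_assoc]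
  _ = t := by rw [H.rel, H.t_eq]

theorem x'_X (H : RelatorIdentities a b t t' x' X Y) : x' * X = X * x' := by
  conv_lhs => rw [H.X_eq']
  conv_rhs => rw [H.X_eq]
  simp only [mul_assoc]

theorem X_t_x'_a (H : RelatorIdentities a b t t' x' X Y) : X * t * x' * a = t * x' * Y * a := calc
  X * t * x' * a = X * t * (x' * X) * Y * a := by
    conv_lhs => rw [← H.rel]
    simp only [mul_assoc]
  _ = (X * t * X) * x' * Y * a := by rw [H.x'_X]; simp only [mul_assoc]
  _ = t * x' * Y * a := by rw [H.X_t_X]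

theorem X_t_a (H : RelatorIdentities a b t t' x' X Y) : X * t * a = t * Y * a := calc
  X * t * a = (X * t * X) * Y * a := by
    conv_lhs => rw [← H.rel]
    simp only [mul_assoc]
  _ = t * Y * a := by rw [H.X_t_X]

theorem S_T (H : RelatorIdentities a b t t' x' X Y) : (x' * b * (x' * b)) * (t * t) * a = a := calc
  (x' * b * (x' * b)) * (t * t) * a = x' * b * ((x' * b * t) * t * a) := by simp only [mul_assoc]
  _ = x' * b * (X * t * a) := by rw [← H.X_eq]
  _ = (x' * b * t) * Y * a := by rw [H.X_t_a]; simp only [mul_assoc]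
  _ = a := by rw [← H.X_eq, H.rel]

theorem c_C (H : RelatorIdentities a b t t' x' X Y) : (x' * b * t') * (a * Y) * a = a := calc
  (x' * b * t') * (a * Y) * a = (x' * b * (t' * a)) * Y * a := by simp only [mul_assoc]
  _ = a := by rw [← H.t_eq', ← H.X_eq, H.rel]

theorem d_D (H : RelatorIdentities a b t t' x' X Y) : (b * (x' * b)) * (t * t * x') * a = a := calc
  (b * (x' * b)) * (t * t * x') * a = b * ((x' * b * t) * t * x' * a) := by simp only [mul_assoc]
  _ = (b * t * x') * Y * a := by rw [← H.X_eq, H.X_t_x'_a]; simp only [mul_assoc]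
  _ = a := by rw [← H.X_eq', H.rel]

theorem Y_T (H : RelatorIdentities a b t t' x' X Y) : Y * (t * t) * a = t * t * Y * a := calc
  Y * (t * t) * a = (Y * t) * t * a := by simp only [mul_assoc]
  _ = t * (X * t * a) := by rw [H.Y_mul_t]; simp only [mul_assoc]
  _ = t * t * Y * a := by rw [H.X_t_a]; simp only [mul_assoc]

theorem C_T (H : RelatorIdentities a b t t' x' X Y) :
    a * Y * (t * t) * a = t * t * (a * Y) * a := calc
  a * Y * (t * t) * a = a * (Y * (t * t) * a) := by simp only [mul_assoc]
  _ = (a * t) * t * Y * a := by rw [H.Y_T]; simp only [mul_assoc]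
  _ = (t * a) * t * Y * a := by rw [← H.t_comm]
  _ = t * (a * t) * Y * a := by simp only [mul_assoc]
  _ = t * (t * a) * Y * a := by rw [← H.t_comm]
  _ = t * t * (a * Y) * a := by simp only [mul_assoc]

theorem Y_D (H : RelatorIdentities a b t t' x' X Y) :
    Y * (t * t * x') * a = t * t * x' * Y * a := calc
  Y * (t * t * x') * a = (Y * t) * t * x' * a := by simp only [mul_assoc]
  _ = t * (X * t * x' * a) := by rw [H.Y_mul_t]; simp only [mul_assoc]
  _ = t * t * x' * Y * a := by rw [H.X_t_x'_a]; simp only [mul_assoc]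

end RelatorIdentities

theorem relatorIdentities {M : Type*} [Monoid M] (a b : M) (m n : ℕ)
    (h : (b * a ^ (n + 1)) ^ (m + 1) * (a ^ (n + 1) * b) ^ (m + 1) * a = a) :
    RelatorIdentities a b (a ^ (n + 1)) (a ^ n) ((b * a ^ (n + 1)) ^ m)
      ((b * a ^ (n + 1)) ^ (m + 1)) ((a ^ (n + 1) * b) ^ (m + 1)) where
  rel := h
  t_eq := pow_succ' a n
  t_eq' := pow_succ a n
  Y_mul_t := by
    have : SemiconjBy (a ^ (n + 1)) (b * a ^ (n + 1)) (a ^ (n + 1) * b) := by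
      simp [SemiconjBy, mul_assoc]
    exact (this.pow_right (m + 1)).symm
  X_eq := by rw [pow_succ, mul_assoc]
  X_eq' := pow_succ' _ _
  exists_Y_eq := ⟨a ^ n * b * (a ^ (n + 1) * b) ^ m, by simp only [pow_succ', mul_assoc]⟩

/-- Elements `T, Y, C, D` of a monoid which, acting by left multiplication on a subset `ideal`
that they preserve, satisfy the commutation relations of the path `C - T - Y - D` and have the left
inverses `S, X, c, d`. -/
structure TraceSystem (M : Type*) [Monoid M] where
  ideal : Set M
  (T Y C D S X c d : M)
  T_mem : ∀ z ∈ ideal, T * z ∈ ideal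
  Y_mem : ∀ z ∈ ideal, Y * z ∈ ideal
  C_mem : ∀ z ∈ ideal, C * z ∈ ideal
  D_mem : ∀ z ∈ ideal, D * z ∈ ideal
  S_T : ∀ z ∈ ideal, S * (T * z) = z
  X_Y : ∀ z ∈ ideal, X * (Y * z) = z
  c_C : ∀ z ∈ ideal, c * (C * z) = z
  d_D : ∀ z ∈ ideal, d * (D * z) = z
  Y_T : ∀ z ∈ ideal, Y * (T * z) = T * (Y * z)
  C_T : ∀ z ∈ ideal, C * (T * z) = T * (C * z)
  Y_D : ∀ z ∈ ideal, Y * (D * z) = D * (Y * z)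

/-- `IsLinked k l N` says that the pairs in `l` link `k` to `N`. -/
inductive IsLinked : ℕ → List (ℕ × ℕ) → ℕ → Prop
  | nil (k : ℕ) : IsLinked k [] k
  | cons {k p N : ℕ} {l : List (ℕ × ℕ)} : IsLinked p l N → IsLinked k ((k, p) :: l) N

theorem IsLinked.append {k j N : ℕ} {l l' : List (ℕ × ℕ)} (h : IsLinked k l j)
    (h' : IsLinked j l' N) : IsLinked k (l ++ l') N := by
  induction h with
  | nil => exact h'
  | cons _ ih => exact .cons (ih h')

theorem IsLinked.exists_of_append {k N : ℕ} {l l' : List (ℕ × ℕ)} (h : IsLinked k (l ++ l') N) :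
    ∃ j, IsLinked k l j ∧ IsLinked j l' N := by
  induction l generalizing k with
  | nil => exact ⟨k, .nil k, h⟩
  | cons x l ih =>
    cases h with
    | cons h =>
      obtain ⟨j, h₁, h₂⟩ := ih h
      exact ⟨j, .cons h₁, h₂⟩

theorem IsLinked.of_eq {k N : ℕ} {l : List (ℕ × ℕ)}
    (h : k :: l.map Prod.snd = l.map Prod.fst ++ [N]) : IsLinked k l N := by
  induction l generalizing k with
  | nil =>
    obtain rfl : k = N := by simpa using h
    exact .nil k
  | cons x l ih =>
    obtain ⟨q, p⟩ := x
    simp only [List.map_cons, List.cons_append, List.cons.injEq] at h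
    obtain ⟨rfl, h⟩ := h
    exact .cons (ih h)

namespace TraceSystem

variable {M : Type*} [Monoid M] (s : TraceSystem M)

/-- The element encoding a list of pairs. -/
def code : List (ℕ × ℕ) → M
  | [] => 1
  | (q, p) :: l => s.D * (s.Y ^ q * (s.T ^ p * (s.C * code l)))

theorem code_append (l l' : List (ℕ × ℕ)) : s.code (l ++ l') = s.code l * s.code l' := by
  induction l with
  | nil => simp [code]
  | cons x l ih => simp [code, ih, mul_assoc]

variable {s}

theorem T_pow_mem {z : M} (hz : z ∈ s.ideal) (k : ℕ) : s.T ^ k * z ∈ s.ideal := by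
  induction k with
  | zero => simpa
  | succ k ih => rw [pow_succ', mul_assoc]; exact s.T_mem _ ih

theorem Y_pow_mem {z : M} (hz : z ∈ s.ideal) (k : ℕ) : s.Y ^ k * z ∈ s.ideal := by
  induction k with
  | zero => simpa
  | succ k ih => rw [pow_succ', mul_assoc]; exact s.Y_mem _ ih

theorem code_mem {z : M} (hz : z ∈ s.ideal) (l : List (ℕ × ℕ)) : s.code l * z ∈ s.ideal := by
  induction l with
  | nil => simpa [code]
  | cons x l ih =>
    simp only [code, mul_assoc]
    exact s.D_mem _ (Y_pow_mem (T_pow_mem (s.C_mem _ ih) _) _)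

theorem S_pow_T_pow {z : M} (hz : z ∈ s.ideal) (k : ℕ) : s.S ^ k * (s.T ^ k * z) = z := by
  induction k with
  | zero => simp
  | succ k ih =>
    rw [pow_succ, pow_succ', mul_assoc, mul_assoc, s.S_T _ (T_pow_mem hz k), ih]

theorem X_pow_Y_pow {z : M} (hz : z ∈ s.ideal) (k : ℕ) : s.X ^ k * (s.Y ^ k * z) = z := by
  induction k with
  | zero => simp
  | succ k ih =>
    rw [pow_succ, pow_succ', mul_assoc, mul_assoc, s.X_Y _ (Y_pow_mem hz k), ih]

theorem Y_T_pow {z : M} (hz : z ∈ s.ideal) (k : ℕ) :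
    s.Y * (s.T ^ k * z) = s.T ^ k * (s.Y * z) := by
  induction k with
  | zero => simp
  | succ k ih =>
    rw [pow_succ', mul_assoc, s.Y_T _ (T_pow_mem hz k), ih, mul_assoc]

theorem Y_pow_T_pow {z : M} (hz : z ∈ s.ideal) (j k : ℕ) :
    s.Y ^ j * (s.T ^ k * z) = s.T ^ k * (s.Y ^ j * z) := by
  induction j with
  | zero => simp
  | succ j ih =>
    rw [pow_succ', mul_assoc, ih, Y_T_pow (Y_pow_mem hz j), mul_assoc]

theorem C_T_pow {z : M} (hz : z ∈ s.ideal) (k : ℕ) :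
    s.C * (s.T ^ k * z) = s.T ^ k * (s.C * z) := by
  induction k with
  | zero => simp
  | succ k ih =>
    rw [pow_succ', mul_assoc, s.C_T _ (T_pow_mem hz k), ih, mul_assoc]

theorem Y_pow_D {z : M} (hz : z ∈ s.ideal) (k : ℕ) :
    s.Y ^ k * (s.D * z) = s.D * (s.Y ^ k * z) := by
  induction k with
  | zero => simp
  | succ k ih =>
    rw [pow_succ', mul_assoc, ih, s.Y_D _ (Y_pow_mem hz k), mul_assoc]

theorem T_Y_pow {z : M} (hz : z ∈ s.ideal) (k : ℕ) :
    (s.T * s.Y) ^ k * z = s.T ^ k * (s.Y ^ k * z) := by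
  induction k with
  | zero => simp
  | succ k ih =>
    rw [pow_succ', mul_assoc, ih, mul_assoc, Y_T_pow (Y_pow_mem hz k), pow_succ', pow_succ',
      mul_assoc, mul_assoc]

theorem X_pow_S_pow {z : M} (hz : z ∈ s.ideal) (B B' q p : ℕ) :
    s.X ^ B * (s.S ^ B' * (s.Y ^ (B + q) * (s.T ^ (B' + p) * z))) =
      s.Y ^ q * (s.T ^ p * z) := by
  have h := T_pow_mem hz p
  rw [pow_add s.T, mul_assoc, Y_pow_T_pow h, S_pow_T_pow (Y_pow_mem h _), pow_add, mul_assoc,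
    X_pow_Y_pow (Y_pow_mem h _)]

/-- The inverse of an element encoding one pair of an affine family. -/
theorem affine_inverse {z : M} (hz : z ∈ s.ideal) (A A' B B' i : ℕ) :
    s.c * ((s.X ^ A * s.S ^ A') ^ i * (s.X ^ B * s.S ^ B' * (s.d *
      (s.code [(A * i + B, A' * i + B')] * z)))) = z := by
  have key : ∀ i, ∀ z ∈ s.ideal,
      (s.X ^ A * s.S ^ A') ^ i * (s.Y ^ (A * i) * (s.T ^ (A' * i) * z)) = z := by
    intro i
    induction i with
    | zero => simp
    | succ i ih =>
      intro z hz
      have h := X_pow_S_pow hz A A' (A * i) (A' * i)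
      rw [pow_succ, mul_assoc, mul_assoc, show A * (i + 1) = A + A * i by ring,
        show A' * (i + 1) = A' + A' * i by ring, h, ih z hz]
  have hC := s.C_mem z hz
  simp only [code, mul_one, mul_assoc]
  rw [s.d_D _ (Y_pow_mem (T_pow_mem hC _) _), add_comm (A * i), add_comm (A' * i),
    X_pow_S_pow hC, key i _ hC, s.c_C _ hz]

/-- `u` is a left inverse of the element encoding `l`. -/
def Inverts (s : TraceSystem M) (u : M) (l : List (ℕ × ℕ)) : Prop :=
  ∀ z ∈ s.ideal, u * (s.code l * z) = z

theorem Inverts.mul {u u' : M} {l l' : List (ℕ × ℕ)} (h : s.Inverts u l) (h' : s.Inverts u' l') :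
    s.Inverts (u' * u) (l ++ l') := by
  intro z hz
  rw [code_append, mul_assoc, mul_assoc, h _ (code_mem hz _), h' z hz]

theorem inverts_one : s.Inverts 1 [] := fun z _ => by simp [code]

/-- The encoding of a linked list can be rewritten with the blocks `T * Y` and `D * C` only. -/
theorem exists_blocks {k N : ℕ} {l : List (ℕ × ℕ)} (h : IsLinked k l N) {z : M}
    (hz : z ∈ s.ideal) :
    ∃ v : List M, (∀ g ∈ v, g = s.T * s.Y ∨ g = s.D * s.C) ∧
      s.T ^ k * (s.code l * (s.Y ^ N * z)) = v.prod * z := by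
  induction h with
  | nil k =>
    refine ⟨List.replicate k (s.T * s.Y), fun g hg => .inl (List.eq_of_mem_replicate hg), ?_⟩
    simp [code, T_Y_pow hz]
  | @cons k p N l h ih =>
    obtain ⟨v, hv, e⟩ := ih
    refine ⟨List.replicate k (s.T * s.Y) ++ s.D * s.C :: v, ?_, ?_⟩
    · intro g hg
      rcases List.mem_append.1 hg with hg | hg
      · exact .inl (List.eq_of_mem_replicate hg)
      · rcases List.mem_cons.1 hg with rfl | hg
        · exact .inr rfl
        · exact hv g hg
    · have hm := code_mem (Y_pow_mem hz N) l
      have hr := s.C_mem _ (T_pow_mem hm p)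
      simp only [code, mul_assoc, List.prod_append, List.prod_cons, List.prod_replicate]
      rw [← e, T_Y_pow (s.D_mem _ hr), Y_pow_D hr, ← C_T_pow hm]

variable (s)

/-- The product `(T * Y) ^ k * (D * C) * (T * Y) ^ k₁ * (D * C) * ⋯`. -/
def blocks (k : ℕ) : List ℕ → M
  | [] => (s.T * s.Y) ^ k
  | j :: js => (s.T * s.Y) ^ k * (s.D * s.C * blocks j js)

theorem blocks_succ (k : ℕ) (js : List ℕ) :
    s.blocks (k + 1) js = s.T * s.Y * s.blocks k js := by
  cases js <;> simp [blocks, pow_succ', mul_assoc]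

theorem exists_blocks_eq {v : List M} (hv : ∀ g ∈ v, g = s.T * s.Y ∨ g = s.D * s.C) :
    ∃ k js, v.prod = s.blocks k js := by
  induction v with
  | nil => exact ⟨0, [], by simp [blocks]⟩
  | cons g v ih =>
    obtain ⟨k, js, e⟩ := ih fun g hg => hv g (List.mem_cons_of_mem _ hg)
    rcases hv g (by simp) with rfl | rfl
    · exact ⟨k + 1, js, by rw [blocks_succ, List.prod_cons, e]⟩
    · exact ⟨0, k :: js, by simp [blocks, e]⟩

section Orbit

variable {Γ Ω : Type*} [Group Γ] [MulAction Γ Ω]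

/-- Alternately apply `h` and powers of `g` to the base point `x`. -/
def orbit (g h : Γ) (x : Ω) (es : List ℤ) : Ω := es.foldr (fun e y => g ^ e • h • y) x

theorem orbit_cons (g h : Γ) (x : Ω) (e : ℤ) (es : List ℤ) :
    orbit g h x (e :: es) = g ^ e • h • orbit g h x es := rfl

theorem orbit_nil (g h : Γ) (x : Ω) : orbit g h x [] = x := rfl

variable {s} (f : M →* Γ) {g h : Γ} {k₀ : ℤ} (x : Ω)

theorem blocks_smul_snd (hT : f s.T = g ^ k₀) (hY : f s.Y = 1) (hC : f s.C = g)
    (hD : f s.D = g ^ k₀ * h) (k : ℕ) (js : List ℕ) :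
    f (s.blocks k js) • f s.D • x =
      g ^ (-1 : ℤ) • orbit g h x ((k :: js).map fun k : ℕ => k₀ * k + k₀ + 1) := by
  induction js generalizing k with
  | nil =>
    simp only [blocks, map_pow, map_mul, hT, hY, hD, List.map_cons, List.map_nil,
      orbit_cons, orbit_nil, smul_smul]
    congr 1; group
  | cons j js ih =>
    rw [blocks, map_mul, map_mul, mul_smul, mul_smul, ih]
    simp only [List.map_cons, orbit_cons]
    generalize orbit g h x (List.map _ _) = y
    simp only [map_pow, map_mul, hT, hY, hD, hC, smul_smul]
    congr 1; group

theorem code_smul_snd (hT : f s.T = g ^ k₀) (hY : f s.Y = 1) (hC : f s.C = g)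
    (hD : f s.D = g ^ k₀ * h) (k N : ℕ) (l : List (ℕ × ℕ)) :
    f (s.T ^ k * s.code l * s.Y ^ N) • f s.D • x =
      g ^ (-1 : ℤ) • orbit g h x ((k :: l.map Prod.snd).map fun k : ℕ => k₀ * k + k₀ + 1) := by
  induction l generalizing k with
  | nil =>
    simp only [code, map_pow, map_mul, hT, hY, hD, List.map_cons, List.map_nil,
      orbit_cons, orbit_nil, smul_smul, map_one]
    congr 1; group
  | cons y l ih =>
    obtain ⟨q, p⟩ := y
    have e : f (s.T ^ k * s.code ((q, p) :: l) * s.Y ^ N) =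
        g ^ (k₀ * k + k₀) * h * g * f (s.T ^ p * s.code l * s.Y ^ N) := by
      simp only [code, map_pow, map_mul, hT, hY, hC, hD]
      group
    rw [e, mul_smul, ih]
    simp only [List.map_cons, orbit_cons]
    generalize orbit g h x (List.map _ _) = y
    simp only [smul_smul]
    congr 1; group

theorem blocks_smul_fst (hT : f s.T = 1) (hY : f s.Y = g ^ (-k₀)) (hC : f s.C = h * g ^ (-k₀))
    (hD : f s.D = g ^ (k₀ - 1)) (k : ℕ) (js : List ℕ) :
    f (s.blocks k js) • f s.D • h • x =
      g ^ k₀ • orbit g h x ((k :: js).map fun k : ℕ => -k₀ * k - 1) := by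
  induction js generalizing k with
  | nil =>
    simp only [blocks, map_pow, map_mul, hT, hY, hD, List.map_cons, List.map_nil,
      orbit_cons, orbit_nil, smul_smul]
    congr 1; group
  | cons j js ih =>
    rw [blocks, map_mul, map_mul, mul_smul, mul_smul, ih]
    simp only [List.map_cons, orbit_cons]
    generalize orbit g h x (List.map _ _) = y
    simp only [map_pow, map_mul, hT, hY, hD, hC, smul_smul]
    congr 1; group

theorem code_smul_fst (hT : f s.T = 1) (hY : f s.Y = g ^ (-k₀)) (hC : f s.C = h * g ^ (-k₀))
    (hD : f s.D = g ^ (k₀ - 1)) (k N : ℕ) (l : List (ℕ × ℕ)) :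
    f (s.T ^ k * s.code l * s.Y ^ N) • f s.D • h • x =
      g ^ k₀ • orbit g h x ((l.map Prod.fst ++ [N]).map fun k : ℕ => -k₀ * k - 1) := by
  induction l generalizing k with
  | nil =>
    simp only [code, map_pow, map_mul, hT, hY, hD, List.map_cons, List.map_nil,
      List.nil_append, orbit_cons, orbit_nil, smul_smul, map_one]
    congr 1; group
  | cons y l ih =>
    obtain ⟨q, p⟩ := y
    have e : f (s.T ^ k * s.code ((q, p) :: l) * s.Y ^ N) =
        g ^ (k₀ - 1 - k₀ * q) * h * g ^ (-k₀) * f (s.T ^ p * s.code l * s.Y ^ N) := by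
      simp only [code, map_pow, map_mul, hT, hY, hC, hD]
      group
    rw [e, mul_smul, ih]
    simp only [List.map_cons, List.cons_append, orbit_cons]
    generalize orbit g h x (List.map _ _) = y
    simp only [smul_smul]
    congr 1; group

end Orbit

end TraceSystem

namespace TwistedAction

open Monoid

variable {r : ℕ} {ι : Type*}

/-- The free group with basis `ι`, as a free product of infinite cyclic groups. -/
abbrev CyclicProduct (ι : Type*) := CoprodI fun _ : ι => Multiplicative ℤ

/-- Fibrewise left multiplication. -/
def mulBy : (ZMod r → CyclicProduct ι) →* Equiv.Perm (ZMod r × CyclicProduct ι) where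
  toFun g := Equiv.prodShear (Equiv.refl _) fun j => Equiv.mulLeft (g j)
  map_one' := by ext x <;> simp
  map_mul' g h := by ext x <;> simp

/-- Translation of the base. -/
def shift : Equiv.Perm (ZMod r × CyclicProduct ι) :=
  (Equiv.addRight 1).prodCongr (Equiv.refl _)

theorem mulBy_apply (g : ZMod r → CyclicProduct ι) (x) : mulBy g x = (x.1, g x.1 * x.2) := rfl

theorem shift_apply (x : ZMod r × CyclicProduct ι) : shift x = (x.1 + 1, x.2) := rfl

theorem shift_pow_apply (k : ℕ) (x : ZMod r × CyclicProduct ι) :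
    (shift ^ k) x = (x.1 + k, x.2) := by
  induction k with
  | zero => simp
  | succ k ih => rw [pow_succ', Equiv.Perm.mul_apply, ih, shift_apply]; simp [add_assoc]

theorem shift_pow_eq_one : (shift : Equiv.Perm (ZMod r × CyclicProduct ι)) ^ r = 1 := by
  ext x <;> simp [shift_pow_apply]

/-- The function `j ↦ (c j) ^ (s j)`, where `c j` is regarded as a basis element. -/
def gens (c : ZMod r → ι) (s : ZMod r → ℤ) (j : ZMod r) : CyclicProduct ι :=
  CoprodI.of (i := c j) (Multiplicative.ofAdd (s j))

/-- The orbit of a base point under alternating translations and powers of `mulBy`. -/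
def act (c : ZMod r → ι) (s : ZMod r → ℤ) : List ℤ → ZMod r × CyclicProduct ι
  | [] => (0, 1)
  | e :: es => (mulBy (gens c s) ^ e) (shift (act c s es))

/-- The syllables of the second coordinate of `act`. -/
def syllables (c : ZMod r → ι) (s : ZMod r → ℤ) : List ℤ → List (Σ _ : ι, Multiplicative ℤ)
  | [] => []
  | e :: es => ⟨c (es.length + 1), Multiplicative.ofAdd (e * s (es.length + 1))⟩ ::
      syllables c s es

variable {c : ZMod r → ι} {s : ZMod r → ℤ}

theorem syllables_injective (hs : ∀ j, s j ≠ 0) : Function.Injective (syllables c s) := by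
  intro es es' h
  induction es generalizing es' with
  | nil => cases es' with
    | nil => rfl
    | cons e es' => simp [syllables] at h
  | cons e es ih => cases es' with
    | nil => simp [syllables] at h
    | cons e' es' =>
      simp only [syllables, List.cons.injEq] at h
      obtain rfl := ih h.2
      have h1 := h.1
      simp only [Sigma.mk.injEq, heq_eq_eq, true_and] at h1
      have := Multiplicative.ofAdd.injective h1
      rw [mul_right_cancel₀ (hs _) this]

theorem act_eq (es : List ℤ) : act c s es =
    ((es.length : ZMod r), ((syllables c s es).map fun l => CoprodI.of (i := l.1) l.2).prod) := by
  induction es with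
  | nil => simp [act, syllables]
  | cons e es ih =>
    rw [act, ih, ← map_zpow, shift_apply, mulBy_apply]
    simp only [syllables, gens, Pi.pow_apply, ← map_zpow, ← ofAdd_zsmul, smul_eq_mul,
      List.length_cons, List.map_cons, List.prod_cons]
    push_cast
    rfl

variable [DecidableEq ι]

/-- The syllables form a reduced word. -/
def word (hc : ∀ j, c (j + 1) ≠ c j) (hs : ∀ j, s j ≠ 0) (es : List ℤ) (he : ∀ e ∈ es, e ≠ 0) :
    CoprodI.Word (fun _ : ι => Multiplicative ℤ) where
  toList := syllables c s es
  ne_one := by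
    intro l hl
    induction es with
    | nil => simp [syllables] at hl
    | cons e es ih =>
      rcases List.mem_cons.1 hl with rfl | hl
      · exact ofAdd_eq_one.not.2 (mul_ne_zero (he e (by simp)) (hs _))
      · exact ih (fun e h => he e (List.mem_cons_of_mem _ h)) hl
  chain_ne := by
    clear he
    induction es with
    | nil => simp [syllables]
    | cons e es ih =>
      cases es with
      | nil => simp [syllables]
      | cons e' es =>
        simp only [syllables] at ih ⊢
        refine List.isChain_cons_cons.2 ⟨?_, ih⟩
        simpa using hc _

theorem act_injOn (hc : ∀ j, c (j + 1) ≠ c j) (hs : ∀ j, s j ≠ 0) {es es' : List ℤ}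
    (he : ∀ e ∈ es, e ≠ 0) (he' : ∀ e ∈ es', e ≠ 0) (h : act c s es = act c s es') : es = es' := by
  rw [act_eq, act_eq] at h
  have key : (word hc hs es he).prod = (word hc hs es' he').prod := congrArg Prod.snd h
  have := CoprodI.Word.equiv.symm.injective key
  exact syllables_injective hs (congrArg CoprodI.Word.toList this)

end TwistedAction

/-- The trace system attached to the identities following from the relator. -/
def RelatorIdentities.traceSystem {M : Type*} [Monoid M] {a b t t' x' X Y : M}
    (H : RelatorIdentities a b t t' x' X Y) : TraceSystem M where
  ideal := {z | ∃ w, z = a * w}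
  T := t * t
  Y := Y
  C := a * Y
  D := t * t * x'
  S := x' * b * (x' * b)
  X := X
  c := x' * b * t'
  d := b * (x' * b)
  T_mem := by rintro _ ⟨w, rfl⟩; exact ⟨t' * t * a * w, by rw [H.t_eq]; simp only [mul_assoc]⟩
  Y_mem := by
    rintro _ ⟨w, rfl⟩
    obtain ⟨y, hy⟩ := H.exists_Y_eq
    exact ⟨y * a * w, by rw [hy]; simp only [mul_assoc]⟩
  C_mem := by rintro _ ⟨w, rfl⟩; exact ⟨Y * a * w, by simp only [mul_assoc]⟩
  D_mem := by
    rintro _ ⟨w, rfl⟩; exact ⟨t' * t * x' * a * w, by rw [H.t_eq]; simp only [mul_assoc]⟩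
  S_T := by rintro _ ⟨w, rfl⟩; simpa only [mul_assoc] using congrArg (· * w) H.S_T
  X_Y := by rintro _ ⟨w, rfl⟩; simpa only [mul_assoc] using congrArg (· * w) H.rel
  c_C := by rintro _ ⟨w, rfl⟩; simpa only [mul_assoc] using congrArg (· * w) H.c_C
  d_D := by rintro _ ⟨w, rfl⟩; simpa only [mul_assoc] using congrArg (· * w) H.d_D
  Y_T := by rintro _ ⟨w, rfl⟩; simpa only [mul_assoc] using congrArg (· * w) H.Y_T
  C_T := by rintro _ ⟨w, rfl⟩; simpa only [mul_assoc] using congrArg (· * w) H.C_T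
  Y_D := by rintro _ ⟨w, rfl⟩; simpa only [mul_assoc] using congrArg (· * w) H.Y_D

section Soundness

open TraceSystem TwistedAction

variable {M : Type*} [Monoid M] {a b : M} {m n : ℕ}

theorem exists_hom_of_conj
    (hlift : ∀ (Γ : Type) [Group Γ] (α β : Γ),
      (β * α ^ (n + 1)) ^ (m + 1) * (α ^ (n + 1) * β) ^ (m + 1) * α = α →
        ∃ f : M →* Γ, f a = α ∧ f b = β)
    (h : (b * a ^ (n + 1)) ^ (m + 1) * (a ^ (n + 1) * b) ^ (m + 1) * a = a)
    {Γ : Type} [Group Γ] (α ξ : Γ)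
    (hξ : ξ ^ (m + 1) * (α ^ (n + 1) * ξ ^ (m + 1)) = α ^ (n + 1)) :
    ∃ f : M →* Γ, f (relatorIdentities a b m n h).traceSystem.T = α ^ (2 * (n + 1)) ∧
      f (relatorIdentities a b m n h).traceSystem.Y = (ξ ^ (m + 1))⁻¹ ∧
      f (relatorIdentities a b m n h).traceSystem.C = α * (ξ ^ (m + 1))⁻¹ ∧
      f (relatorIdentities a b m n h).traceSystem.D = α ^ (2 * (n + 1)) * ξ ^ m := by
  have e1 : ξ * (α ^ (n + 1))⁻¹ * α ^ (n + 1) = ξ := by group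
  have e2 : (α ^ (n + 1) * (ξ * (α ^ (n + 1))⁻¹)) ^ (m + 1) = (ξ ^ (m + 1))⁻¹ := by
    rw [← mul_assoc, conj_pow, mul_inv_eq_iff_eq_mul, eq_inv_mul_iff_mul_eq, hξ]
  obtain ⟨f, ha, hb⟩ := hlift Γ α (ξ * (α ^ (n + 1))⁻¹) (by rw [e1, e2]; group)
  have hY : f ((a ^ (n + 1) * b) ^ (m + 1)) = (ξ ^ (m + 1))⁻¹ := by
    rw [map_pow, map_mul, map_pow, ha, hb, e2]
  have hT : f (a ^ (n + 1) * a ^ (n + 1)) = α ^ (2 * (n + 1)) := by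
    rw [map_mul, map_pow, ha, two_mul, pow_add α (n + 1)]
  refine ⟨f, hT, hY, ?_, ?_⟩
  · change f (a * (a ^ (n + 1) * b) ^ (m + 1)) = _
    rw [map_mul, ha, hY]
  · change f (a ^ (n + 1) * a ^ (n + 1) * (b * a ^ (n + 1)) ^ m) = _
    rw [map_mul, hT, map_pow, map_mul, map_pow, ha, hb, e1]

/-- The sign function on `ZMod (2 * N)` that is negated by translation by `N`. -/
def halfSign (N : ℕ) (j : ZMod (2 * N)) : ℤ := if j.val < N then 1 else -1

theorem halfSign_add (N : ℕ) [NeZero N] (j : ZMod (2 * N)) :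
    halfSign N (j + N) = -halfSign N j := by
  have hN : 0 < N := NeZero.pos N
  have hj := ZMod.val_lt j
  have : (j + (N : ZMod (2 * N))).val = (j.val + N) % (2 * N) := by
    rw [ZMod.val_add, ZMod.val_natCast, Nat.add_mod_mod]
  unfold halfSign
  rw [this]
  by_cases h : j.val < N
  · rw [Nat.mod_eq_of_lt (by omega)]; simp [h]
  · rw [Nat.mod_eq_sub_mod (by omega), Nat.mod_eq_of_lt (by omega)]
    simp [h]; omega

theorem mulBy_pow_mul_shift {r : ℕ} {ι : Type*} {c : ZMod r → ι} {s : ZMod r → ℤ} {N : ℕ}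
    (hs : ∀ j, s (j + N) = -s j) (hc : ∀ j, c (j + N) = c j) (k : ℕ) :
    mulBy (gens c s) ^ k * (shift ^ N * mulBy (gens c s) ^ k) = shift ^ N := by
  ext1 x
  rw [Equiv.Perm.mul_apply, Equiv.Perm.mul_apply, shift_pow_apply, shift_pow_apply, ← map_pow,
    mulBy_apply, mulBy_apply]
  simp only [Pi.pow_apply, gens]
  rw [hs, hc, ofAdd_neg, map_inv, inv_pow, inv_mul_cancel_left]

theorem orbit_eq_act {r : ℕ} {ι : Type*} {c : ZMod r → ι} {s : ZMod r → ℤ} (es : List ℤ) :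
    orbit (mulBy (gens c s)) shift ((0, 1) : ZMod r × CyclicProduct ι) es = act c s es := by
  induction es with
  | nil => rfl
  | cons e es ih => rw [orbit_cons, ih]; rfl

theorem map_snd_eq (hm : 1 ≤ m)
    (hlift : ∀ (Γ : Type) [Group Γ] (α β : Γ),
      (β * α ^ (n + 1)) ^ (m + 1) * (α ^ (n + 1) * β) ^ (m + 1) * α = α →
        ∃ f : M →* Γ, f a = α ∧ f b = β)
    (h : (b * a ^ (n + 1)) ^ (m + 1) * (a ^ (n + 1) * b) ^ (m + 1) * a = a)
    {k k' N : ℕ} {js : List ℕ} {l : List (ℕ × ℕ)}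
    (heq : ∀ (Γ : Type) [Group Γ] (f : M →* Γ),
      f ((relatorIdentities a b m n h).traceSystem.blocks k js) =
        f ((relatorIdentities a b m n h).traceSystem.T ^ k' *
          (relatorIdentities a b m n h).traceSystem.code l *
          (relatorIdentities a b m n h).traceSystem.Y ^ N)) :
    k :: js = k' :: l.map Prod.snd := by
  classical
  have : Fact (1 < m + 1) := ⟨by omega⟩
  let Ω := ZMod (m + 1) × CyclicProduct (ZMod (m + 1))
  let Γ := Equiv.Perm Ω
  let α : Γ := mulBy (gens id fun _ => 1)
  have hs : (shift : Γ)⁻¹ ^ (m + 1) = 1 := by rw [inv_pow, shift_pow_eq_one, inv_one]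
  obtain ⟨f, hT, hY, hC, hD⟩ := exists_hom_of_conj hlift h α shift⁻¹ (by rw [hs]; simp)
  rw [hs, inv_one] at hY hC
  rw [mul_one] at hC
  have hD' : f (relatorIdentities a b m n h).traceSystem.D = α ^ (2 * (n + 1) : ℤ) * shift := by
    rw [hD, show (shift : Γ)⁻¹ ^ m = shift by
      rw [← mul_left_inj ((shift : Γ)⁻¹), ← pow_succ, hs, mul_inv_cancel]]
    norm_cast
  have hT' : f (relatorIdentities a b m n h).traceSystem.T = α ^ (2 * (n + 1) : ℤ) := by
    rw [hT]; norm_cast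
  have e := congrArg (fun g : Γ =>
    g • f (relatorIdentities a b m n h).traceSystem.D • ((0, 1) : Ω)) (heq Γ f)
  rw [blocks_smul_snd f (0, 1) hT' hY hC hD', code_smul_snd f (0, 1) hT' hY hC hD',
    smul_left_cancel_iff, orbit_eq_act, orbit_eq_act] at e
  have ne : ∀ L : List ℕ,
      ∀ e ∈ L.map (fun k : ℕ => (2 * (n + 1) : ℤ) * k + 2 * (n + 1) + 1), e ≠ 0 := by
    simp only [List.mem_map]
    rintro L _ ⟨k, -, rfl⟩
    positivity
  refine List.map_injective_iff.2 ?_ (act_injOn (fun j => by simp) (by simp) (ne _) (ne _) e)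
  intro i j hij
  simpa [show ((n : ℤ) + 1) ≠ 0 by positivity] using hij

theorem map_fst_eq (hn : 1 ≤ n)
    (hlift : ∀ (Γ : Type) [Group Γ] (α β : Γ),
      (β * α ^ (n + 1)) ^ (m + 1) * (α ^ (n + 1) * β) ^ (m + 1) * α = α →
        ∃ f : M →* Γ, f a = α ∧ f b = β)
    (h : (b * a ^ (n + 1)) ^ (m + 1) * (a ^ (n + 1) * b) ^ (m + 1) * a = a)
    {k k' N : ℕ} {js : List ℕ} {l : List (ℕ × ℕ)}
    (heq : ∀ (Γ : Type) [Group Γ] (f : M →* Γ),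
      f ((relatorIdentities a b m n h).traceSystem.blocks k js) =
        f ((relatorIdentities a b m n h).traceSystem.T ^ k' *
          (relatorIdentities a b m n h).traceSystem.code l *
          (relatorIdentities a b m n h).traceSystem.Y ^ N)) :
    k :: js = l.map Prod.fst ++ [N] := by
  classical
  have : Fact (1 < n + 1) := ⟨by omega⟩
  let Ω := ZMod (2 * (n + 1)) × CyclicProduct (ZMod (n + 1))
  let Γ := Equiv.Perm Ω
  let c : ZMod (2 * (n + 1)) → ZMod (n + 1) := ZMod.castHom (Dvd.intro_left 2 rfl) _
  let ξ : Γ := mulBy (gens c (halfSign (n + 1)))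
  have hα : (shift : Γ) ^ (2 * (n + 1)) = 1 := shift_pow_eq_one
  have hξ : ξ ^ (m + 1) * ((shift : Γ) ^ (n + 1) * ξ ^ (m + 1)) = (shift : Γ) ^ (n + 1) := by
    refine mulBy_pow_mul_shift (halfSign_add (n + 1)) (fun j => ?_) _
    simp only [c, map_add, map_natCast, ZMod.natCast_self, add_zero]
  obtain ⟨f, hT, hY, hC, hD⟩ := exists_hom_of_conj hlift h shift ξ hξ
  rw [hα] at hT hD
  have hY' : f (relatorIdentities a b m n h).traceSystem.Y = ξ ^ (-(m + 1) : ℤ) := by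
    rw [hY, zpow_neg]; norm_cast
  have hC' : f (relatorIdentities a b m n h).traceSystem.C = shift * ξ ^ (-(m + 1) : ℤ) := by
    rw [hC, zpow_neg]; norm_cast
  have hD' : f (relatorIdentities a b m n h).traceSystem.D = ξ ^ ((m + 1) - 1 : ℤ) := by
    rw [hD, one_mul, add_sub_cancel_right, zpow_natCast]
  have e := congrArg (fun g : Γ =>
    g • f (relatorIdentities a b m n h).traceSystem.D • (shift : Γ) • ((0, 1) : Ω)) (heq Γ f)
  rw [blocks_smul_fst f (0, 1) hT hY' hC' hD', code_smul_fst f (0, 1) hT hY' hC' hD',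
    smul_left_cancel_iff, orbit_eq_act, orbit_eq_act] at e
  have ne : ∀ L : List ℕ, ∀ e ∈ L.map (fun k : ℕ => -(m + 1 : ℤ) * k - 1), e ≠ 0 := by
    simp only [List.mem_map]
    rintro L _ ⟨k, -, rfl⟩
    have : 0 ≤ (m + 1 : ℤ) * k := by positivity
    linarith
  refine List.map_injective_iff.2 ?_ (act_injOn (fun j => ?_) (fun j => ?_) (ne _) (ne _) e)
  · intro i j hij
    have hne : -((m : ℤ) + 1) ≠ 0 := neg_ne_zero.2 (by positivity)
    simpa only [sub_left_inj, mul_right_inj' hne, Nat.cast_inj] using hij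
  · simp [c]
  · unfold halfSign; split <;> decide

theorem isLinked_of_mul_prod_mul_eq (hm : 1 ≤ m) (hn : 1 ≤ n)
    (hlift : ∀ (Γ : Type) [Group Γ] (α β : Γ),
      (β * α ^ (n + 1)) ^ (m + 1) * (α ^ (n + 1) * β) ^ (m + 1) * α = α →
        ∃ f : M →* Γ, f a = α ∧ f b = β)
    (h : (b * a ^ (n + 1)) ^ (m + 1) * (a ^ (n + 1) * b) ^ (m + 1) * a = a)
    {s : TraceSystem M} (hs : s = (relatorIdentities a b m n h).traceSystem)
    {u : M} {v : List M} {l : List (ℕ × ℕ)} {N : ℕ} (hu : s.Inverts u l)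
    (hv : ∀ g ∈ v, g = s.T * s.Y ∨ g = s.D * s.C)
    (he : u * (s.S * (v.prod * a)) = s.Y ^ N * a) : IsLinked 1 l N := by
  have ha : a ∈ s.ideal := by rw [hs]; exact ⟨1, (mul_one a).symm⟩
  obtain ⟨k, js, e⟩ := s.exists_blocks_eq hv
  have key : ∀ (Γ : Type) [Group Γ] (f : M →* Γ),
      f (s.blocks k js) = f (s.T ^ 1 * s.code l * s.Y ^ N) := by
    intro Γ _ f
    have h1 := congrArg f (hu a ha)
    have h2 := congrArg f (s.S_T a ha)
    have h3 := congrArg f he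
    rw [← e]
    simp only [map_mul, ← mul_assoc, mul_left_inj, mul_eq_right] at h1 h2 h3
    rw [pow_one, map_mul, map_mul, ← h3, ← mul_eq_one_iff_inv_eq.1 h1,
      eq_inv_of_mul_eq_one_left h2]
    group
  subst hs
  refine .of_eq ?_
  rw [← map_snd_eq hm hlift h key, map_fst_eq hn hlift h key]

end Soundness

namespace OneRelMonoid

open scoped Computability

variable {κ : ℕ} {p q : List (Fin κ)}

theorem eval_nil : eval p q [] = 1 := rfl

theorem eval_append (u v : List (Fin κ)) : eval p q (u ++ v) = eval p q u * eval p q v := rfl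

theorem eval_listPow (w : List (Fin κ)) (i : ℕ) : eval p q (listPow w i) = eval p q w ^ i := by
  induction i with
  | zero => simp [listPow, eval_nil]
  | succ i ih =>
    rw [pow_succ', ← ih, ← eval_append]
    simp [listPow, List.replicate_succ]

theorem eval_surjective : Function.Surjective (eval p q) := PresentedMonoid.surjective_mk

theorem exists_prod_eq_eval (B : Language (Fin κ)) {w : List (Fin κ)}
    (hw : w ∈ B∗) :
    ∃ v : List (OneRelMonoid p q), (∀ g ∈ v, ∃ u ∈ B, g = eval p q u) ∧ v.prod = eval p q w := by
  obtain ⟨L, rfl, hL⟩ := Language.mem_kstar.1 hw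
  clear hw
  refine ⟨L.map (eval p q), fun g hg => ?_, ?_⟩
  · obtain ⟨u, hu, rfl⟩ := List.mem_map.1 hg
    exact ⟨u, hL u hu, rfl⟩
  · clear hL
    induction L with
    | nil => rfl
    | cons u L ih => rw [List.map_cons, List.prod_cons, ih, List.flatten_cons, eval_append]

theorem exists_eval_eq_prod (B : Language (Fin κ)) (v : List (OneRelMonoid p q))
    (hv : ∀ g ∈ v, ∃ u ∈ B, g = eval p q u) :
    ∃ w ∈ B∗, eval p q w = v.prod := by
  induction v with
  | nil => exact ⟨[], Language.nil_mem_kstar _, rfl⟩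
  | cons g v ih =>
    obtain ⟨w, hw, e⟩ := ih fun g hg => hv g (List.mem_cons_of_mem _ hg)
    obtain ⟨u, hu, rfl⟩ := hv g (by simp)
    exact ⟨u ++ w, Language.append_mem_kstar (Language.mem_kstar_of_mem hu) hw, by
      rw [eval_append, e, List.prod_cons]⟩

end OneRelMonoid

section Realizable

open OneRelMonoid Language
open scoped Computability

variable {κ : ℕ} {p q : List (Fin κ)}

/-- A relation on natural numbers is realizable if it is the relation of linked lists of pairs
whose inverses form a regular language. -/
def IsRealizable (s : TraceSystem (OneRelMonoid p q)) (r : ℕ → ℕ → Prop) : Prop :=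
  ∃ L : Language (Fin κ), L.IsRegular ∧
    (∀ u ∈ L, ∃ l, s.Inverts (eval p q u) l ∧ ∀ i j, IsLinked i l j → r i j) ∧
    ∀ i j, r i j → ∃ u ∈ L, ∃ l, s.Inverts (eval p q u) l ∧ IsLinked i l j

namespace IsRealizable

variable {s : TraceSystem (OneRelMonoid p q)} {r r' : ℕ → ℕ → Prop}

theorem comp (h : IsRealizable s r) (h' : IsRealizable s r') :
    IsRealizable s (Relation.Comp r r') := by
  obtain ⟨L, hL, hs, hc⟩ := h
  obtain ⟨L', hL', hs', hc'⟩ := h'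
  refine ⟨L' * L, hL'.mul hL, ?_, ?_⟩
  · rintro _ ⟨u', hu', u, hu, rfl⟩
    obtain ⟨l, hl, hr⟩ := hs u hu
    obtain ⟨l', hl', hr'⟩ := hs' u' hu'
    refine ⟨l ++ l', hl.mul hl', fun i j h => ?_⟩
    obtain ⟨k, h₁, h₂⟩ := h.exists_of_append
    exact ⟨k, hr _ _ h₁, hr' _ _ h₂⟩
  · rintro i j ⟨k, h₁, h₂⟩
    obtain ⟨u, hu, l, hl, hk⟩ := hc _ _ h₁
    obtain ⟨u', hu', l', hl', hk'⟩ := hc' _ _ h₂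
    exact ⟨u' ++ u, Set.mem_image2_of_mem hu' hu, l ++ l', hl.mul hl', hk.append hk'⟩

theorem or (h : IsRealizable s r) (h' : IsRealizable s r') :
    IsRealizable s fun i j => r i j ∨ r' i j := by
  obtain ⟨L, hL, hs, hc⟩ := h
  obtain ⟨L', hL', hs', hc'⟩ := h'
  refine ⟨L + L', hL.add hL', ?_, ?_⟩
  · rintro u (hu | hu)
    · obtain ⟨l, hl, hr⟩ := hs u hu
      exact ⟨l, hl, fun i j h => .inl (hr i j h)⟩
    · obtain ⟨l, hl, hr⟩ := hs' u hu
      exact ⟨l, hl, fun i j h => .inr (hr i j h)⟩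
  · rintro i j (h | h)
    · obtain ⟨u, hu, h⟩ := hc i j h
      exact ⟨u, .inl hu, h⟩
    · obtain ⟨u, hu, h⟩ := hc' i j h
      exact ⟨u, .inr hu, h⟩

theorem reflTransGen (h : IsRealizable s r) : IsRealizable s (Relation.ReflTransGen r) := by
  obtain ⟨L, hL, hs, hc⟩ := h
  refine ⟨L∗, hL.kstar, ?_, ?_⟩
  · intro u hu
    obtain ⟨ws, rfl, hws⟩ := Language.mem_kstar.1 hu
    clear hu
    induction ws with
    | nil => exact ⟨[], TraceSystem.inverts_one, fun i j h => by cases h; exact .refl⟩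
    | cons w ws ih =>
      obtain ⟨l, hl, hr⟩ := hs w (hws w (by simp))
      obtain ⟨l', hl', hr'⟩ := ih fun w hw => hws w (List.mem_cons_of_mem _ hw)
      refine ⟨l' ++ l, hl'.mul hl, fun i j h => ?_⟩
      obtain ⟨k, h₁, h₂⟩ := h.exists_of_append
      exact (hr' _ _ h₁).tail (hr _ _ h₂)
  · intro i j h
    induction h with
    | refl => exact ⟨[], Language.nil_mem_kstar _, [], TraceSystem.inverts_one, .nil i⟩
    | tail _ h ih =>
      obtain ⟨u, hu, l, hl, hk⟩ := ih
      obtain ⟨u', hu', l', hl', hk'⟩ := hc _ _ h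
      exact ⟨u' ++ u, append_mem_kstar (mem_kstar_of_mem hu') hu, l ++ l', hl.mul hl',
        hk.append hk'⟩

theorem affine (A A' B B' : ℕ) :
    IsRealizable s fun i j => ∃ k, i = A * k + B ∧ j = A' * k + B' := by
  obtain ⟨wc, hc⟩ := eval_surjective s.c
  obtain ⟨wA, hA⟩ := eval_surjective (s.X ^ A * s.S ^ A')
  obtain ⟨wB, hB⟩ := eval_surjective (s.X ^ B * s.S ^ B' * s.d)
  have inv : ∀ i, s.Inverts (s.c * ((s.X ^ A * s.S ^ A') ^ i * (s.X ^ B * s.S ^ B' * s.d)))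
      [(A * i + B, A' * i + B')] := fun i z hz => by
    simpa only [mul_assoc] using TraceSystem.affine_inverse hz A A' B B' i
  refine ⟨({wc} : Language (Fin κ)) *
    (({wA} : Language (Fin κ))∗ *
      ({wB} : Language (Fin κ)) : Language (Fin κ)),
    (IsRegular.singleton _).mul ((IsRegular.singleton _).kstar.mul (IsRegular.singleton _)), ?_, ?_⟩
  · rintro _ ⟨_, rfl, _, ⟨w, hw, _, rfl, rfl⟩, rfl⟩
    obtain ⟨v, hv, e⟩ := exists_prod_eq_eval (p := p) (q := q) _ hw
    have hv' : v = List.replicate v.length (s.X ^ A * s.S ^ A') := by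
      refine List.eq_replicate_of_mem fun g hg => ?_
      obtain ⟨_, rfl, rfl⟩ := hv g hg
      exact hA
    rw [hv', List.prod_replicate] at e
    refine ⟨[(A * v.length + B, A' * v.length + B')], ?_, fun i j h => ?_⟩
    · dsimp only
      rw [eval_append, eval_append, hc, hB, ← e]
      exact inv v.length
    · cases h with
      | cons h => cases h; exact ⟨_, rfl, rfl⟩
  · rintro _ _ ⟨k, rfl, rfl⟩
    obtain ⟨w, hw, e⟩ := exists_eval_eq_prod (p := p) (q := q) ({wA} : Language (Fin κ))
      (List.replicate k (s.X ^ A * s.S ^ A'))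
      fun g hg => ⟨wA, rfl, by rw [hA, List.eq_of_mem_replicate hg]⟩
    refine ⟨_, Set.mem_image2_of_mem rfl (Set.mem_image2_of_mem hw rfl), _, ?_, .cons (.nil _)⟩
    rw [eval_append, eval_append, hc, hB, e, List.prod_replicate]
    exact inv k

end IsRealizable

theorem IsRealizable.exists_language {a b : OneRelMonoid p q} {m n : ℕ} (hm : 1 ≤ m) (hn : 1 ≤ n)
    (hlift : ∀ (Γ : Type) [Group Γ] (α β : Γ),
      (β * α ^ (n + 1)) ^ (m + 1) * (α ^ (n + 1) * β) ^ (m + 1) * α = α →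
        ∃ f : OneRelMonoid p q →* Γ, f a = α ∧ f b = β)
    (h : (b * a ^ (n + 1)) ^ (m + 1) * (a ^ (n + 1) * b) ^ (m + 1) * a = a)
    {r : ℕ → ℕ → Prop} (hr : IsRealizable (relatorIdentities a b m n h).traceSystem r) :
    ∃ L : Language (Fin κ), L.IsRegular ∧ ∀ N : ℕ,
      (((a ^ (n + 1) * b) ^ (m + 1)) ^ N * a ∈ eval p q '' L ↔ r 1 N) := by
  obtain ⟨s, hs⟩ : ∃ s, s = (relatorIdentities a b m n h).traceSystem := ⟨_, rfl⟩
  have hY : (a ^ (n + 1) * b) ^ (m + 1) = s.Y := by rw [hs]; rfl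
  have ha : a ∈ s.ideal := by rw [hs]; exact ⟨1, (mul_one a).symm⟩
  rw [← hs] at hr
  rw [hY]
  obtain ⟨L, hL, hsound, hcomp⟩ := hr
  obtain ⟨wS, eS⟩ := eval_surjective s.S
  obtain ⟨w₁, e₁⟩ := eval_surjective (s.T * s.Y)
  obtain ⟨w₂, e₂⟩ := eval_surjective (s.D * s.C)
  obtain ⟨wa, ea⟩ := eval_surjective a
  let B : Language (Fin κ) := ({w₁} : Language (Fin κ)) + ({w₂} : Language (Fin κ))
  refine ⟨L * (({wS} : Language (Fin κ)) * (B∗ *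
      ({wa} : Language (Fin κ)))),
    hL.mul ((IsRegular.singleton _).mul
      ((IsRegular.add (IsRegular.singleton _) (IsRegular.singleton _)).kstar.mul
        (IsRegular.singleton _))), fun N => ⟨?_, ?_⟩⟩
  · rintro ⟨_, ⟨u, hu, _, ⟨_, rfl, _, ⟨w, hw, _, rfl, rfl⟩, rfl⟩, rfl⟩, e⟩
    obtain ⟨v, hv, ev⟩ := exists_prod_eq_eval (p := p) (q := q) _ hw
    obtain ⟨l, hl, hr⟩ := hsound u hu
    refine hr _ _ (isLinked_of_mul_prod_mul_eq hm hn hlift h hs hl (v := v) (fun g hg => ?_) ?_)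
    · obtain ⟨_, rfl | rfl, rfl⟩ := hv g hg
      · exact .inl e₁
      · exact .inr e₂
    · dsimp only at e
      rw [← e, eval_append, eval_append, eval_append, eS, ea, ev]
  · intro h1
    obtain ⟨u, hu, l, hl, hk⟩ := hcomp _ _ h1
    obtain ⟨v, hv, ev⟩ := TraceSystem.exists_blocks hk ha
    obtain ⟨w, hw, e⟩ := exists_eval_eq_prod (p := p) (q := q) B v fun g hg =>
      (hv g hg).elim (fun h => ⟨w₁, .inl rfl, h.trans e₁.symm⟩)
        (fun h => ⟨w₂, .inr rfl, h.trans e₂.symm⟩)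
    refine ⟨_, Set.mem_image2_of_mem hu (Set.mem_image2_of_mem rfl
      (Set.mem_image2_of_mem hw rfl)), ?_⟩
    have hYa := TraceSystem.Y_pow_mem ha N
    rw [eval_append, eval_append, eval_append, eS, ea, e, ← ev, pow_one,
      s.S_T _ (TraceSystem.code_mem hYa l), hl _ hYa]

end Realizable

/-- The closure of the arithmetic relations `A * k + B ↦ A' * k + B'` under composition, union and
iteration. -/
inductive IsAffineKleene : (ℕ → ℕ → Prop) → Prop
  | affine (A A' B B' : ℕ) : IsAffineKleene fun i j => ∃ k, i = A * k + B ∧ j = A' * k + B'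
  | comp {r r' : ℕ → ℕ → Prop} : IsAffineKleene r → IsAffineKleene r' →
      IsAffineKleene (Relation.Comp r r')
  | or {r r' : ℕ → ℕ → Prop} : IsAffineKleene r → IsAffineKleene r' →
      IsAffineKleene fun i j => r i j ∨ r' i j
  | reflTransGen {r : ℕ → ℕ → Prop} : IsAffineKleene r → IsAffineKleene (Relation.ReflTransGen r)

namespace RegisterProgram

open Function

/-- The content of register `i` of the state encoded by `N`: the exponent of the `i`-th prime. -/
noncomputable def reg (N i : ℕ) : ℕ := N.factorization (Nat.nth Nat.Prime i)

theorem reg_one (i : ℕ) : reg 1 i = 0 := by simp [reg]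

theorem reg_mul_prime {N : ℕ} (hN : N ≠ 0) (i : ℕ) :
    reg (Nat.nth Nat.Prime i * N) = update (reg N) i (reg N i + 1) := by
  have hp := Nat.prime_nth_prime i
  funext j
  rw [reg, Nat.factorization_mul hp.ne_zero hN, hp.factorization]
  by_cases h : j = i
  · subst h; simp [reg, add_comm]
  · rw [update_of_ne h]
    simp [reg, (Nat.nth_injective Nat.infinite_setOfPred_prime).ne (Ne.symm h)]

theorem reg_injective {N N' : ℕ} (hN : N ≠ 0) (hN' : N' ≠ 0) (h : ∀ i, reg N i = reg N' i) :
    N = N' := by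
  refine Nat.eq_of_factorization_eq hN hN' fun p => ?_
  by_cases hp : p.Prime
  · simpa [reg, Nat.nth_count hp] using h (Nat.count Nat.Prime p)
  · simp [Nat.factorization_eq_zero_of_not_prime _ hp]

theorem reg_eq_zero_iff {N : ℕ} (hN : N ≠ 0) (i : ℕ) :
    reg N i = 0 ↔ ¬ Nat.nth Nat.Prime i ∣ N := by
  simp [reg, Nat.factorization_eq_zero_iff, Nat.prime_nth_prime, hN]

/-- Increment register `i`. -/
def inc (i N N' : ℕ) : Prop := N' = Nat.nth Nat.Prime i * N

/-- Decrement register `i`, which must be nonzero. -/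
def dec (i N K : ℕ) : Prop := N = Nat.nth Nat.Prime i * K

/-- Test that register `i` is zero. -/
def tst (i N N' : ℕ) : Prop := N = N' ∧ ¬ Nat.nth Nat.Prime i ∣ N

theorem _root_.IsAffineKleene.congr {r r' : ℕ → ℕ → Prop} (h : IsAffineKleene r)
    (hr : ∀ i j, r i j ↔ r' i j) : IsAffineKleene r' := by
  rwa [← show r = r' from funext₂ fun i j => propext (hr i j)]

theorem isAffineKleene_inc (i : ℕ) : IsAffineKleene (inc i) :=
  (IsAffineKleene.affine 1 (Nat.nth Nat.Prime i) 0 0).congr fun N N' => by simp [inc]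

theorem isAffineKleene_dec (i : ℕ) : IsAffineKleene (dec i) :=
  (IsAffineKleene.affine (Nat.nth Nat.Prime i) 1 0 0).congr fun N N' => by simp [dec]

theorem isAffineKleene_tst (i : ℕ) : IsAffineKleene (tst i) := by
  obtain ⟨b, hb⟩ := Nat.exists_eq_add_of_le' (Nat.prime_nth_prime i).two_le
  have : ∀ b P, IsAffineKleene fun N N' => ∃ t ≤ b, ∃ k, N = P * k + (t + 1) ∧ N' = N := by
    intro b P
    induction b with
    | zero =>
      refine (IsAffineKleene.affine P P 1 1).congr fun N N' => ?_
      simp only [nonpos_iff_eq_zero, exists_eq_left]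
      exact exists_congr fun k => and_congr_right fun h => by rw [h]
    | succ b ih =>
      refine (ih.or (IsAffineKleene.affine P P (b + 2) (b + 2))).congr fun N N' => ?_
      constructor
      · rintro (⟨t, ht, h⟩ | ⟨k, rfl, rfl⟩)
        · exact ⟨t, ht.trans (Nat.le_succ b), h⟩
        · exact ⟨b + 1, le_rfl, k, rfl, rfl⟩
      · rintro ⟨t, ht, k, rfl, rfl⟩
        rcases ht.lt_or_eq with h | rfl
        · exact .inl ⟨t, Nat.lt_succ_iff.1 h, k, rfl, rfl⟩
        · exact .inr ⟨k, rfl, rfl⟩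
  refine (this b (Nat.nth Nat.Prime i)).congr fun N N' => ?_
  rw [tst, Nat.dvd_iff_mod_eq_zero, hb]
  constructor
  · rintro ⟨t, ht, k, rfl, rfl⟩
    refine ⟨rfl, ?_⟩
    rw [Nat.mul_add_mod, Nat.mod_eq_of_lt (by omega)]
    omega
  · rintro ⟨rfl, h⟩
    have := Nat.mod_lt N (show 0 < b + 2 by omega)
    have h2 := Nat.div_add_mod N (b + 2)
    exact ⟨N % (b + 2) - 1, by omega, N / (b + 2), by omega, rfl⟩

/-- There is a total nondeterministic program using finitely many registers all of whose runs
satisfy `P`. -/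
def Impl (P : (ℕ → ℕ) → (ℕ → ℕ) → Prop) : Prop :=
  ∃ r, IsAffineKleene r ∧ ∃ M, ∀ N ≠ 0, (∃ N', r N N') ∧
    ∀ N', r N N' → N' ≠ 0 ∧ P (reg N) (reg N') ∧ ∀ j ≥ M, reg N' j = reg N j

namespace Impl

variable {P Q : (ℕ → ℕ) → (ℕ → ℕ) → Prop}

theorem mono (h : Impl P) (hPQ : ∀ s t, P s t → Q s t) : Impl Q := by
  obtain ⟨r, hr, M, h⟩ := h
  exact ⟨r, hr, M, fun N hN => ⟨(h N hN).1, fun N' h' =>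
    ⟨((h N hN).2 N' h').1, hPQ _ _ ((h N hN).2 N' h').2.1, ((h N hN).2 N' h').2.2⟩⟩⟩

theorem seq (hP : Impl P) (hQ : Impl Q) : Impl (Relation.Comp P Q) := by
  obtain ⟨r, hr, M, h⟩ := hP
  obtain ⟨r', hr', M', h'⟩ := hQ
  refine ⟨_, hr.comp hr', max M M', fun N hN => ⟨?_, ?_⟩⟩
  · obtain ⟨N₁, h₁⟩ := (h N hN).1
    obtain ⟨N₂, h₂⟩ := (h' N₁ ((h N hN).2 _ h₁).1).1
    exact ⟨N₂, N₁, h₁, h₂⟩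
  · rintro N₂ ⟨N₁, h₁, h₂⟩
    obtain ⟨hN₁, hP, e⟩ := (h N hN).2 _ h₁
    obtain ⟨hN₂, hQ, e'⟩ := (h' N₁ hN₁).2 _ h₂
    exact ⟨hN₂, ⟨_, hP, hQ⟩, fun j hj =>
      (e' j (le_of_max_le_right hj)).trans (e j (le_of_max_le_left hj))⟩

theorem skip : Impl Eq := by
  refine ⟨_, (IsAffineKleene.affine 1 1 0 0), 0, fun N hN => ⟨⟨N, N, by simp, by simp⟩, ?_⟩⟩
  rintro _ ⟨k, h, rfl⟩
  rw [← h]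
  exact ⟨hN, rfl, fun _ _ => rfl⟩

theorem inc (i : ℕ) : Impl fun s t => t = update s i (s i + 1) := by
  refine ⟨_, isAffineKleene_inc i, i + 1, fun N hN => ⟨⟨_, rfl⟩, ?_⟩⟩
  rintro _ rfl
  refine ⟨mul_ne_zero (Nat.prime_nth_prime i).ne_zero hN, reg_mul_prime hN i, fun j hj => ?_⟩
  rw [reg_mul_prime hN, update_of_ne (by omega)]

theorem loop (c : ℕ) (h : Impl P) (hc : ∀ s t, P s t → t c = s c) :
    Impl fun s t => t c = 0 ∧ ∀ I : ℕ → (ℕ → ℕ) → Prop, I 0 s →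
      (∀ i u v w, I i u → v = update u c (u c - 1) → P v w → I (i + 1) w) → I (s c) t := by
  obtain ⟨r, hr, M, h⟩ := h
  have hdec : ∀ N N', N ≠ 0 → dec c N N' → N' ≠ 0 ∧ reg N c = reg N' c + 1 ∧
      reg N' = update (reg N) c (reg N c - 1) := by
    rintro N N' hN rfl
    have hN' : N' ≠ 0 := right_ne_zero_of_mul hN
    simp [hN', reg_mul_prime hN']
  have aux : ∀ N N', N ≠ 0 → Relation.ReflTransGen (Relation.Comp (dec c) r) N N' →
      N' ≠ 0 ∧ (∀ j ≥ max M (c + 1), reg N' j = reg N j) ∧ ∃ i, reg N' c + i = reg N c ∧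
        ∀ I : ℕ → (ℕ → ℕ) → Prop, I 0 (reg N) →
          (∀ i u v w, I i u → v = update u c (u c - 1) → P v w → I (i + 1) w) → I i (reg N') := by
    intro N N' hN h₁
    induction h₁ with
    | refl => exact ⟨hN, fun _ _ => rfl, 0, rfl, fun I h _ => h⟩
    | @tail N₁ N₂ _ h₂ ih =>
      obtain ⟨hN₁, e₁, i, hi, hI⟩ := ih
      obtain ⟨N₃, hd, hrr⟩ := h₂
      obtain ⟨hN₃, e₃, e₃'⟩ := hdec _ _ hN₁ hd
      obtain ⟨hN₂, hP, e₂⟩ := (h N₃ hN₃).2 _ hrr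
      refine ⟨hN₂, fun j hj => ?_, i + 1, by rw [hc _ _ hP]; omega, fun I h0 hs =>
        hs _ _ _ _ (hI I h0 hs) e₃' hP⟩
      rw [e₂ j (le_of_max_le_left hj), e₃', update_of_ne, e₁ j hj]
      have := le_of_max_le_right hj
      omega
  refine ⟨_, ((isAffineKleene_dec c).comp hr).reflTransGen.comp (isAffineKleene_tst c),
    max M (c + 1), fun N hN => ⟨?_, ?_⟩⟩
  · obtain ⟨k, hk⟩ : ∃ k, reg N c = k := ⟨_, rfl⟩
    induction k generalizing N with
    | zero => exact ⟨N, N, .refl, rfl, (reg_eq_zero_iff hN c).1 hk⟩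
    | succ k ih =>
      obtain ⟨N₁, h₁⟩ : ∃ N₁, dec c N N₁ := by
        by_contra hd
        have := (reg_eq_zero_iff hN c).2 fun ⟨N₁, e⟩ => hd ⟨N₁, e⟩
        omega
      obtain ⟨hN₁, e, -⟩ := hdec _ _ hN h₁
      obtain ⟨N₂, h₂⟩ := (h N₁ hN₁).1
      obtain ⟨hN₂, hP, -⟩ := (h N₁ hN₁).2 _ h₂
      obtain ⟨N₃, N₄, h₃, h₄⟩ := ih N₂ hN₂ (by rw [hc _ _ hP]; omega)
      exact ⟨N₃, N₄, .head ⟨N₁, h₁, h₂⟩ h₃, h₄⟩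
  · rintro N' ⟨N₀, h₁, e₀, h₂⟩
    obtain ⟨hN', e, i, hi, hI⟩ := aux N _ hN h₁
    change N₀ = N' at e₀
    subst e₀
    have h0 := (reg_eq_zero_iff hN' c).2 h₂
    rw [h0, zero_add] at hi
    subst hi
    exact ⟨hN', ⟨h0, hI⟩, e⟩

theorem zero (i : ℕ) : Impl fun s t => t i = 0 ∧ ∀ j ≠ i, t j = s j := by
  refine (skip.loop i fun s t h => by rw [h]).mono fun s t ⟨h₁, h₂⟩ => ⟨h₁, ?_⟩
  refine h₂ (fun _ u => ∀ j ≠ i, u j = s j) (fun _ _ => rfl) ?_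
  rintro k u v _ hI rfl rfl j hj
  rw [update_of_ne hj, hI j hj]

theorem copy {i o B : ℕ} (hi : i < B) (ho : o < B) (hio : i ≠ o) :
    Impl fun s t => t o = s i ∧ ∀ j < B, j ≠ o → t j = s j := by
  have l₁ := ((inc o).seq (inc B)).loop i (by
    rintro s _ ⟨_, rfl, rfl⟩
    rw [update_of_ne (by omega), update_of_ne hio])
  have l₂ := (inc i).loop B (by
    rintro s _ rfl
    rw [update_of_ne (by omega)])
  refine ((((zero o).seq (zero B)).seq l₁).seq l₂).mono ?_
  rintro s t ⟨s₃, ⟨s₂, ⟨s₁, ⟨ho₁, e₁⟩, hB₂, e₂⟩, hi₃, e₃⟩, hB₄, e₄⟩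
  have hi₂ : s₂ i = s i := by rw [e₂ _ (by omega), e₁ _ hio]
  obtain ⟨ho₃, hB₃, e₃⟩ := e₃ (fun k u => u o = k ∧ u B = k ∧ ∀ j < B, j ≠ o → j ≠ i → u j = s j)
    ⟨by rw [e₂ _ (by omega), ho₁], hB₂, fun j hj ho _ => by rw [e₂ _ (by omega), e₁ _ ho]⟩ (by
      rintro k u _ _ ⟨h₁, h₂, h₃⟩ rfl ⟨_, rfl, rfl⟩
      refine ⟨?_, ?_, fun j hj hjo hji => ?_⟩
      · rw [update_of_ne (by omega), update_self, update_of_ne hio.symm, h₁]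
      · rw [update_self, update_of_ne (by omega), update_of_ne (by omega), h₂]
      · rw [update_of_ne (by omega), update_of_ne hjo, update_of_ne hji, h₃ j hj hjo hji])
  rw [hi₂] at ho₃ hB₃
  obtain ⟨hi₄, ho₄, e₄⟩ := e₄ (fun k u => u i = k ∧ u o = s i ∧ ∀ j < B, j ≠ o → j ≠ i → u j = s j)
    ⟨hi₃, ho₃, e₃⟩ (by
      rintro k u _ _ ⟨h₁, h₂, h₃⟩ rfl rfl
      refine ⟨?_, ?_, fun j hj hjo hji => ?_⟩
      · rw [update_self, update_of_ne (by omega), h₁]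
      · rw [update_of_ne hio.symm, update_of_ne (by omega), h₂]
      · rw [update_of_ne hji, update_of_ne (by omega), h₃ j hj hjo hji])
  refine ⟨ho₄, fun j hj hjo => ?_⟩
  by_cases hji : j = i
  · rw [hji, hi₄, hB₃]
  · exact e₄ j hj hjo hji

theorem clear (M : ℕ) : Impl fun s t => t 0 = s 0 ∧ (∀ j, 0 < j → j < M → t j = 0) ∧
    ∀ j ≥ M, t j = s j := by
  induction M with
  | zero =>
    refine skip.mono ?_
    rintro s _ rfl
    exact ⟨rfl, by omega, fun _ _ => rfl⟩
  | succ M ih =>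
    rcases M.eq_zero_or_pos with rfl | hM
    · refine skip.mono ?_
      rintro s _ rfl
      exact ⟨rfl, by omega, fun _ _ => rfl⟩
    refine (ih.seq (zero M)).mono ?_
    rintro s t ⟨u, ⟨h₀, h₁, h₂⟩, h₃, h₄⟩
    refine ⟨by rw [h₄ 0 (by omega), h₀], fun j hj hjM => ?_, fun j hj => ?_⟩
    · by_cases h : j = M
      · rw [h, h₃]
      · rw [h₄ j h, h₁ j hj (by omega)]
    · rw [h₄ j (by omega), h₂ j (by omega)]

end Impl

/-- Every primitive recursive function is computed by a register program. -/
theorem impl_of_primrec' {n : ℕ} {f : List.Vector ℕ n → ℕ} (hf : Nat.Primrec' f) :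
    ∀ (ins : Fin n → ℕ) (o B : ℕ), (∀ i, ins i < B) → o < B → (∀ i, ins i ≠ o) →
      Impl fun s t => t o = f (List.Vector.ofFn fun i => s (ins i)) ∧
        ∀ j < B, j ≠ o → t j = s j := by
  induction hf with
  | zero => exact fun ins o B _ _ _ => (Impl.zero o).mono fun s t h => ⟨h.1, fun j _ => h.2 j⟩
  | succ =>
    intro ins o B hB ho hi
    refine ((Impl.copy (hB 0) ho (hi 0)).seq (.inc o)).mono ?_
    rintro s _ ⟨u, ⟨h₁, h₂⟩, rfl⟩
    refine ⟨?_, fun j hj hjo => ?_⟩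
    · rw [update_self, h₁]
      rfl
    · rw [update_of_ne hjo, h₂ j hj hjo]
  | get i =>
    intro ins o B hB ho hi
    refine (Impl.copy (hB i) ho (hi i)).mono fun s t h =>
      ⟨h.1.trans (List.Vector.get_ofFn (fun i => s (ins i)) i).symm, h.2⟩
  | @comp m n f g hf hg ihf ihg =>
    intro ins o B hB ho hi
    have aux : ∀ k ≤ n, Impl fun s t =>
        (∀ i : Fin n, i.1 < k → t (B + i.1) = g i (List.Vector.ofFn fun i => s (ins i))) ∧
          ∀ j < B, t j = s j := by
      intro k hk
      induction k with
      | zero =>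
        refine Impl.skip.mono ?_
        rintro s _ rfl
        exact ⟨fun i hi => absurd hi (Nat.not_lt_zero _), fun _ _ => rfl⟩
      | succ k ih =>
        refine ((ih (by omega)).seq (ihg ⟨k, hk⟩ ins (B + k) (B + n)
          (fun i => (hB i).trans_le (by omega)) (by omega) fun i => ?_)).mono ?_
        · have := hB i
          omega
        rintro s t ⟨u, ⟨h₁, h₂⟩, h₃, h₄⟩
        refine ⟨fun i hik => ?_, fun j hj => ?_⟩
        · rcases (Nat.lt_succ_iff.1 hik).lt_or_eq with h | h
          · rw [h₄ _ (by omega) (by omega), h₁ i h]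
          · obtain rfl : i = ⟨k, hk⟩ := Fin.ext h
            rw [h₃]
            congr 2
            funext i
            exact h₂ _ (hB i)
        · rw [h₄ _ (by omega) (by omega), h₂ j hj]
    refine ((aux n le_rfl).seq (ihf (fun i => B + i.1) o (B + n) (fun i => by omega) (by omega)
      fun i => by omega)).mono ?_
    rintro s t ⟨u, ⟨h₁, h₂⟩, h₃, h₄⟩
    refine ⟨?_, fun j hj hjo => ?_⟩
    · rw [h₃]
      congr 2
      funext i
      exact h₁ i i.2
    · rw [h₄ j (by omega) hjo, h₂ j hj]
  | @prec n f g hf hg ihf ihg =>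
    intro ins o B hB ho hi
    have body := ((ihg (Fin.cons (B + 1) (Fin.cons o fun i => ins i.succ)) (B + 2) (B + 3)
      (by
        refine Fin.cases (by simp) (Fin.cases ?_ fun i => ?_)
        · simp only [Fin.cons_succ, Fin.cons_zero]; omega
        · have := hB i.succ
          simp only [Fin.cons_succ]; omega)
      (by omega)
      (by
        refine Fin.cases (by simp) (Fin.cases ?_ fun i => ?_)
        · simp only [Fin.cons_succ, Fin.cons_zero]; omega
        · have := hB i.succ
          simp only [Fin.cons_succ]; omega)).seq
      (Impl.copy (i := B + 2) (o := o) (B := B + 3) (by omega) (by omega) (by omega))).seq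
        (Impl.inc (B + 1))
    have hbody := body.loop B (by
      rintro s _ ⟨v, ⟨u, ⟨-, h₁⟩, -, h₂⟩, rfl⟩
      rw [update_of_ne (by omega), h₂ _ (by omega) (by omega), h₁ _ (by omega) (by omega)])
    refine ((((Impl.copy (i := ins 0) (o := B) (B := B + 1) (by have := hB 0; omega) (by omega)
      (hB 0).ne).seq (Impl.zero (B + 1))).seq (ihf (fun i => ins i.succ) o (B + 3)
        (fun i => by have := hB i.succ; omega) (by omega) fun i => hi _)).seq hbody).mono ?_
    rintro s t ⟨s₃, ⟨s₂, ⟨s₁, ⟨hc₁, e₁⟩, hy₂, e₂⟩, ho₃, e₃⟩, -, ht⟩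
    have e₂' : ∀ j < B, s₂ j = s j := fun j hj => by
      rw [e₂ _ (by omega), e₁ _ (by omega) (by omega)]
    have e₃' : ∀ j < B, j ≠ o → s₃ j = s j := fun j hj hjo => by
      rw [e₃ _ (by omega) hjo, e₂' _ hj]
    have hc₃ : s₃ B = s (ins 0) := by
      rw [e₃ _ (by omega) (by omega), e₂ _ (by omega), hc₁]
    have htail : (fun i : Fin n => s₂ (ins i.succ)) = fun i => s (ins i.succ) :=
      funext fun i => e₂' _ (hB _)
    rw [htail] at ho₃
    rw [hc₃] at ht
    obtain ⟨-, h₁, h₂⟩ := ht (fun k u => u (B + 1) = k ∧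
        u o = Nat.rec (f (List.Vector.ofFn fun i => s (ins i.succ)))
          (fun y IH => g (y ::ᵥ IH ::ᵥ List.Vector.ofFn fun i => s (ins i.succ))) k ∧
        ∀ j < B, j ≠ o → u j = s j)
      ⟨by rw [e₃ _ (by omega) (by omega), hy₂], ho₃, e₃'⟩ (by
        rintro k u v _ ⟨hy, hu, e⟩ rfl ⟨v₂, ⟨v₁, ⟨h₁, e₁⟩, h₂, e₂⟩, rfl⟩
        have hout : v₁ (B + 2) =
            g (k ::ᵥ u o ::ᵥ List.Vector.ofFn fun i => s (ins i.succ)) := by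
          rw [h₁]
          congr 1
          rw [List.Vector.ofFn, List.Vector.ofFn]
          simp only [Fin.cons_succ, Fin.cons_zero]
          rw [update_of_ne (by omega), update_of_ne (by omega), hy]
          congr 3
          funext i
          rw [update_of_ne (hB _).ne, e _ (hB _) (hi _)]
        refine ⟨?_, ?_, fun j hj hjo => ?_⟩
        · rw [update_self, e₂ _ (by omega) (by omega), e₁ _ (by omega) (by omega),
            update_of_ne (by omega), hy]
        · rw [update_of_ne (by omega), h₂, hout, hu]
        · rw [update_of_ne (by omega), e₂ _ (by omega) hjo, e₁ _ (by omega) (by omega),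
            update_of_ne (by omega), e j hj hjo])
    exact ⟨h₁, h₂⟩

theorem reflTransGen_inc_iff (i N N' : ℕ) :
    Relation.ReflTransGen (inc i) N N' ↔ ∃ k, N' = Nat.nth Nat.Prime i ^ k * N := by
  constructor
  · intro h
    induction h with
    | refl => exact ⟨0, by simp⟩
    | tail _ h ih =>
      obtain ⟨k, rfl⟩ := ih
      exact ⟨k + 1, by rw [pow_succ', mul_assoc]; exact h⟩
  · rintro ⟨k, rfl⟩
    induction k with
    | zero => simpa using Relation.ReflTransGen.refl
    | succ k ih => exact ih.tail (by rw [pow_succ', mul_assoc]; rfl)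

theorem reg_prime_pow_mul {N : ℕ} (hN : N ≠ 0) (i k : ℕ) :
    reg (Nat.nth Nat.Prime i ^ k * N) = update (reg N) i (reg N i + k) := by
  induction k with
  | zero => simp
  | succ k ih =>
    rw [pow_succ', mul_assoc, reg_mul_prime
      (mul_ne_zero (pow_ne_zero _ (Nat.prime_nth_prime i).ne_zero) hN), ih]
    simp [add_assoc]

theorem reg_two_pow (e : ℕ) : reg (2 ^ e) = update (reg 1) 0 e := by
  have := reg_prime_pow_mul one_ne_zero 0 e
  rw [Nat.nth_prime_zero_eq_two, mul_one] at this
  rw [this, reg_one, zero_add]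

/-- The projection of a decidable relation with primitive recursive characteristic function is
enumerated, via `e ↦ 2 ^ e`, by the image of `1` under a relation in the affine Kleene closure. -/
theorem exists_isAffineKleene {g : ℕ → ℕ → ℕ} (hg : Primrec₂ g) :
    ∃ r, IsAffineKleene r ∧ ∀ e, r 1 (2 ^ e) ↔ ∃ k, g e k = 0 := by
  obtain ⟨r, hr, M, h⟩ := impl_of_primrec' (Nat.Primrec'.prim_iff₂.2 hg) (fun i => i.1) 2 3
    (fun i => i.2.trans (by omega)) (by omega) fun i => i.2.ne
  obtain ⟨r', hr', M', h'⟩ := Impl.clear (M + 2)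
  refine ⟨_, ((((isAffineKleene_inc 0).reflTransGen.comp
    (isAffineKleene_inc 1).reflTransGen).comp hr).comp (isAffineKleene_tst 2)).comp hr',
    fun e => ?_⟩
  have hN : ∀ e k, Nat.nth Nat.Prime 1 ^ k * 2 ^ e ≠ 0 := fun e k =>
    mul_ne_zero (pow_ne_zero _ (Nat.prime_nth_prime 1).ne_zero) (by positivity)
  have hreg : ∀ e k, reg (Nat.nth Nat.Prime 1 ^ k * 2 ^ e) = update (update (reg 1) 0 e) 1 k :=
    fun e k => by
      rw [reg_prime_pow_mul (by positivity), reg_two_pow, update_of_ne one_ne_zero, reg_one,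
        zero_add]
  have run : ∀ e k N, r (Nat.nth Nat.Prime 1 ^ k * 2 ^ e) N → N ≠ 0 ∧ reg N 0 = e ∧
      reg N 2 = g e k ∧ ∀ j ≥ M + 2, reg N j = 0 := by
    intro e k N hrN
    obtain ⟨h₁, ⟨h₂, h₃⟩, h₄⟩ := (h _ (hN e k)).2 N hrN
    simp only [hreg] at h₂ h₃ h₄
    refine ⟨h₁, (h₃ 0 (by omega) (by omega)).trans (by simp), h₂.trans rfl, fun j hj => ?_⟩
    rw [h₄ j (by omega), update_of_ne (by omega), update_of_ne (by omega), reg_one]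
  constructor
  · rintro ⟨_, ⟨N₃, ⟨N₂, ⟨N₁, h₁, h₂⟩, h₃⟩, rfl, ht⟩, h₅⟩
    obtain ⟨e', rfl⟩ := (reflTransGen_inc_iff _ _ _).1 h₁
    obtain ⟨k, rfl⟩ := (reflTransGen_inc_iff _ _ _).1 h₂
    rw [mul_one, Nat.nth_prime_zero_eq_two] at h₃
    obtain ⟨hN₃, e₀, e₂, -⟩ := run e' k N₃ h₃
    obtain ⟨-, ⟨e₅, -⟩, -⟩ := (h' N₃ hN₃).2 _ h₅
    rw [reg_two_pow, update_self, e₀] at e₅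
    exact ⟨k, by rw [e₅, ← e₂, (reg_eq_zero_iff hN₃ 2).2 ht]⟩
  · rintro ⟨k, hk⟩
    obtain ⟨N₃, h₃⟩ := (h _ (hN e k)).1
    obtain ⟨hN₃, e₀, e₂, e₃⟩ := run e k N₃ h₃
    obtain ⟨N₅, h₅⟩ := (h' N₃ hN₃).1
    obtain ⟨hN₅, ⟨e₅, e₆, e₇⟩, -⟩ := (h' N₃ hN₃).2 _ h₅
    have : N₅ = 2 ^ e := by
      refine reg_injective hN₅ (by positivity) fun j => ?_
      rw [reg_two_pow]
      rcases j.eq_zero_or_pos with rfl | hj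
      · rw [e₅, e₀, update_self]
      · rw [update_of_ne hj.ne', reg_one]
        by_cases hjM : j < M + 2
        · exact e₆ j hj hjM
        · rw [e₇ j (by omega), e₃ j (by omega)]
    subst this
    exact ⟨N₃, ⟨N₃, ⟨_, ⟨_, (reflTransGen_inc_iff _ _ _).2 ⟨e, rfl⟩,
      (reflTransGen_inc_iff _ _ _).2 ⟨k, rfl⟩⟩, by
        rwa [mul_one, Nat.nth_prime_zero_eq_two]⟩, rfl,
        (reg_eq_zero_iff hN₃ 2).1 (e₂.trans hk)⟩, h₅⟩

end RegisterProgram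

/-- The halting problem is enumerated by a relation in the affine Kleene closure. -/
theorem exists_isAffineKleene_halting :
    ∃ r, IsAffineKleene r ∧ ∀ c : Nat.Partrec.Code,
      r 1 (2 ^ Encodable.encode c) ↔ (c.eval 0).Dom := by
  let g : ℕ → ℕ → ℕ := fun e k =>
    bif (Nat.Partrec.Code.evaln k (Denumerable.ofNat Nat.Partrec.Code e) 0).isSome then 0 else 1
  have hg : Primrec₂ g := Primrec.cond (Primrec.option_isSome.comp
    (Nat.Partrec.Code.primrec_evaln.comp (.pair (.pair .snd ((Primrec.ofNat _).comp .fst))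
      (.const 0)))) (.const 0) (.const 1)
  obtain ⟨r, hr, h⟩ := RegisterProgram.exists_isAffineKleene hg
  refine ⟨r, hr, fun c => (h _).trans ?_⟩
  simp only [g, Denumerable.ofNat_encode]
  rw [Part.dom_iff_mem]
  simp only [Nat.Partrec.Code.evaln_complete]
  rw [exists_comm]
  refine exists_congr fun k => ?_
  cases Nat.Partrec.Code.evaln k c 0 <;> simp

theorem IsAffineKleene.isRealizable {κ : ℕ} {p q : List (Fin κ)}
    (s : TraceSystem (OneRelMonoid p q)) {r : ℕ → ℕ → Prop} (h : IsAffineKleene r) :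
    IsRealizable s r := by
  induction h with
  | affine A A' B B' => exact .affine A A' B B'
  | comp _ _ h h' => exact h.comp h'
  | or _ _ h h' => exact h.or h'
  | reflTransGen _ h => exact h.reflTransGen

theorem primrec_listPow {σ : Type*} [Primcodable σ] (w : List σ) :
    Primrec (listPow w) :=
  (Primrec.nat_rec₁ [] (Primrec.list_append.comp (.const w) .snd).to₂).of_eq fun i => by
    induction i with
    | zero => simp [listPow]
    | succ i ih => simp_all [listPow, List.replicate_succ]

open OneRelMonoid in
/-- In `R_{m,n}` with `m, n ≥ 2`, every relation in the affine Kleene closure reduces to membership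
in a rational subset: the words `((a ^ n b) ^ m) ^ N a` that lie in it are those with `r 1 N`. -/
theorem IsAffineKleene.exists_language_rmn {m n : ℕ} (hm : 1 ≤ m) (hn : 1 ≤ n)
    {r : ℕ → ℕ → Prop} (hr : IsAffineKleene r) :
    ∃ L : Language (Fin 2), L.IsRegular ∧ ∀ N : ℕ,
      (eval (rmnLhs (m + 1) (n + 1)) aw
        (listPow (listPow (listPow aw (n + 1) ++ bw) (m + 1)) N ++ aw) ∈
          eval (rmnLhs (m + 1) (n + 1)) aw '' L ↔ r 1 N) := by
  have h : (eval (rmnLhs (m + 1) (n + 1)) aw bw * eval (rmnLhs (m + 1) (n + 1)) aw aw ^ (n + 1)) ^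
      (m + 1) * (eval (rmnLhs (m + 1) (n + 1)) aw aw ^ (n + 1) *
        eval (rmnLhs (m + 1) (n + 1)) aw bw) ^ (m + 1) * eval (rmnLhs (m + 1) (n + 1)) aw aw =
      eval (rmnLhs (m + 1) (n + 1)) aw aw := by
    simp only [← eval_listPow, ← eval_append]
    exact PresentedMonoid.mk_eq_mk_of_rel ⟨rfl, rfl⟩
  obtain ⟨L, hL, hiff⟩ := IsRealizable.exists_language hm hn (fun Γ _ α β hαβ => by
    refine ⟨PresentedMonoid.lift ![α, β] ?_, ?_, ?_⟩
    · rintro _ _ ⟨rfl, rfl⟩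
      have hpow : ∀ (w : List (Fin 2)) (i : ℕ), FreeMonoid.ofList (listPow w i) =
          FreeMonoid.ofList w ^ i := by
        intro w i
        induction i with
        | zero => rfl
        | succ i ih =>
          rw [pow_succ', ← ih, ← FreeMonoid.ofList_append]
          simp [listPow, List.replicate_succ]
      have ha : FreeMonoid.lift ![α, β] (FreeMonoid.ofList aw) = α := by simp [aw]
      have hb : FreeMonoid.lift ![α, β] (FreeMonoid.ofList bw) = β := by simp [bw]
      simp only [rmnLhs, FreeMonoid.ofList_append, hpow, map_mul, map_pow, ha, hb]
      exact hαβ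
    · exact PresentedMonoid.lift_of _ _
    · exact PresentedMonoid.lift_of _ _) h (hr.isRealizable _)
  exact ⟨L, hL, fun N => by simpa only [eval_append, eval_listPow] using hiff N⟩

/-- For all `m, n ≥ 2`, the one-relation monoid
`R_{m,n} = Mon⟨a, b | (b a^n)^m (a^n b)^m a = a⟩` contains a fixed rational subset in
which membership is undecidable: there is a regular language `L` over `{a, b}` such that
membership of the represented element in the image of `L` in `R_{m,n}` is not computable. -/
theorem rmn_undecidable_rational_subset_membership (m n : ℕ) (hm : 2 ≤ m) (hn : 2 ≤ n) :
    ∃ L : Language (Fin 2), L.IsRegular ∧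
      ¬ ComputablePred fun w : List (Fin 2) =>
        OneRelMonoid.eval (rmnLhs m n) aw w ∈
          OneRelMonoid.eval (rmnLhs m n) aw '' L := by
  obtain ⟨m, rfl⟩ := Nat.exists_eq_add_of_le' (show 1 ≤ m by omega)
  obtain ⟨n, rfl⟩ := Nat.exists_eq_add_of_le' (show 1 ≤ n by omega)
  obtain ⟨r, hr, hhalt⟩ := exists_isAffineKleene_halting
  obtain ⟨L, hL, hiff⟩ := hr.exists_language_rmn (m := m) (n := n) (by omega) (by omega)
  refine ⟨L, hL, fun hc => ComputablePred.halting_problem 0 ?_⟩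
  refine ComputablePred.computable_of_manyOneReducible ⟨fun c =>
    listPow (listPow (listPow aw (n + 1) ++ bw) (m + 1)) (2 ^ Encodable.encode c) ++ aw, ?_, ?_⟩ hc
  · have hpow : Primrec fun e : ℕ => 2 ^ e :=
      (Primrec.nat_rec₁ 1 (Primrec.nat_mul.comp .snd (.const 2)).to₂).of_eq fun e => by
        induction e with
        | zero => rfl
        | succ e ih => rw [pow_succ, ← ih]
    exact (Primrec.list_append.comp ((primrec_listPow _).comp (hpow.comp .encode))
      (.const aw)).to_comp
  · exact fun c => (hhalt c).symm.trans (hiff _).symm
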